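/- arXiv:1912.08318 — 4 statements merged into one kernel-verified Lean document; each statement's English description precedes it below -/
import Mathlib

section
/- Let n ≥ 1 and let B be a subset of {1,…,2n} with |B| = n. Then B is a basis of the trivial unit interval positroid P_n if and only if either B = {1,…,n}, or B = ({1,…,n} \ {i}) ∪ {j} for some i ∈ {1,…,n} and some j ∈ {n+1,…,2n}. -/
/-- Column `j` (1-indexed, `1 ≤ j ≤ 2n`) of the `n × 2n` matrix `M(n)`: the first `n`
columns form the identity matrix, and each of the last `n` columns has `i`-th entry
`(-1)^(n-i)` (1-indexed rows, realized here with 0-indexed `Fin n`). -/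
def uipCol (n : ℕ) (j : ℕ) : Fin n → ℚ :=
  fun i => if j ≤ n then (if (i : ℕ) + 1 = j then 1 else 0)
           else (-1 : ℚ) ^ (n - 1 - (i : ℕ))

/-- Independent sets of the trivial unit interval positroid `P_n`: subsets of the ground
set `{1, …, 2n}` indexing linearly independent columns of `M(n)`. -/
def uipIndep (n : ℕ) (S : Finset ℕ) : Prop :=
  S ⊆ Finset.Icc 1 (2 * n) ∧
    LinearIndependent ℚ (fun j : {x // x ∈ S} => uipCol n j.1)

/-- Bases of `P_n`: independent sets of size `n`. -/
def uipBasis (n : ℕ) (B : Finset ℕ) : Prop :=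
  uipIndep n B ∧ B.card = n

/-- Circuits of `P_n`: minimal dependent subsets of the ground set. -/
def uipCircuit (n : ℕ) (C : Finset ℕ) : Prop :=
  C ⊆ Finset.Icc 1 (2 * n) ∧ ¬ uipIndep n C ∧ ∀ D ⊂ C, uipIndep n D

/-- `e` is active with respect to `A` in `P_n`: there is a circuit `C` with
`e ∈ C ⊆ A ∪ {e}` and `e = min C`. -/
def uipActive (n : ℕ) (A : Finset ℕ) (e : ℕ) : Prop :=
  ∃ C : Finset ℕ, uipCircuit n C ∧ e ∈ C ∧ C ⊆ insert e A ∧ ∀ x ∈ C, e ≤ x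

/-- The external set `Ext(A)`: active elements with respect to `A` not belonging to `A`. -/
def uipExt (n : ℕ) (A : Finset ℕ) : Set ℕ :=
  {e | uipActive n A e ∧ e ∉ A}

/-- The external order on bases: `A ≤_Ext B` iff `A ⊆ B ∪ Ext(B)`. -/
def uipExtLe (n : ℕ) (A B : Finset ℕ) : Prop :=
  (A : Set ℕ) ⊆ (B : Set ℕ) ∪ uipExt n B

theorem uipCol_of_lt {n j : ℕ} (hj : n < j) :
    uipCol n j = fun i : Fin n => (-1 : ℚ) ^ (n - 1 - (i : ℕ)) := by
  funext i
  simp [uipCol, hj.not_ge]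

theorem sum_smul_uipCol_apply {n : ℕ} {T : Finset ℕ} (hT : T ⊆ Finset.Icc 1 n) (f : ℕ → ℚ)
    (k : Fin n) :
    (∑ x ∈ T, f x • uipCol n x) k = if (k : ℕ) + 1 ∈ T then f (k + 1) else 0 := by
  rw [Finset.sum_apply, ← Finset.sum_ite_eq T ((k : ℕ) + 1) f]
  refine Finset.sum_congr rfl fun x hx => ?_
  have hxn : x ≤ n := (Finset.mem_Icc.mp (hT hx)).2
  simp [uipCol, hxn]

theorem linearIndepOn_uipCol {n : ℕ} {T : Finset ℕ} (hT : T ⊆ Finset.Icc 1 n) :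
    LinearIndepOn ℚ (uipCol n) (T : Set ℕ) := by
  rw [linearIndepOn_finset_iff]
  intro f hf x hx
  obtain ⟨hx1, hxn⟩ := Finset.mem_Icc.mp (hT hx)
  have h := sum_smul_uipCol_apply hT f ⟨x - 1, by omega⟩
  rw [hf] at h
  simpa [Nat.sub_add_cancel hx1, hx] using h.symm

theorem linearIndepOn_uipCol_insert_erase {n i j : ℕ} (hi : i ∈ Finset.Icc 1 n) (hj : n < j) :
    LinearIndepOn ℚ (uipCol n) (insert j ((Finset.Icc 1 n).erase i) : Finset ℕ) := by
  have hT : (Finset.Icc 1 n).erase i ⊆ Finset.Icc 1 n := Finset.erase_subset _ _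
  have hjT : j ∉ (Finset.Icc 1 n).erase i := fun h => by
    have := Finset.mem_Icc.mp (hT h)
    omega
  rw [linearIndepOn_finset_iff]
  intro f hf
  rw [Finset.sum_insert hjT] at hf
  obtain ⟨hi1, hin⟩ := Finset.mem_Icc.mp hi
  have hfj : f j = 0 := by
    have h := congrFun hf ⟨i - 1, by omega⟩
    rw [Pi.add_apply, sum_smul_uipCol_apply hT, uipCol_of_lt hj] at h
    simpa [Nat.sub_add_cancel hi1] using h
  rw [hfj, zero_smul, zero_add] at hf
  intro x hx
  rcases Finset.mem_insert.mp hx with rfl | hx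
  · exact hfj
  · exact linearIndepOn_finset_iff.mp (linearIndepOn_uipCol hT) f hf x hx

/-- A subset of {1,…,2n} of size n is a basis of the trivial UIP P_n iff it is {1,…,n}
or ({1,…,n} \ {i}) ∪ {j} with i ∈ {1,…,n} and j ∈ {n+1,…,2n}. -/
theorem uip_basis_characterization (n : ℕ) (hn : 1 ≤ n) (B : Finset ℕ)
    (hB : B ⊆ Finset.Icc 1 (2 * n)) (hcard : B.card = n) :
    uipBasis n B ↔
      B = Finset.Icc 1 n ∨
        ∃ i ∈ Finset.Icc 1 n, ∃ j ∈ Finset.Icc (n + 1) (2 * n),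
          B = insert j ((Finset.Icc 1 n).erase i) := by
  constructor
  · rintro ⟨⟨-, hli⟩, -⟩
    by_cases hsub : B ⊆ Finset.Icc 1 n
    · exact Or.inl (Finset.eq_of_subset_of_card_le hsub (by simp [hcard]))
    right
    obtain ⟨j, hjB, hj⟩ := Finset.not_subset.mp hsub
    have hj2 := Finset.mem_Icc.mp (hB hjB)
    have hnj : n < j := by
      rw [Finset.mem_Icc] at hj
      omega
    have herase : B.erase j ⊆ Finset.Icc 1 n := by
      intro x hx
      obtain ⟨hxj, hxB⟩ := Finset.mem_erase.mp hx
      have hx2 := Finset.mem_Icc.mp (hB hxB)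
      refine Finset.mem_Icc.mpr ⟨hx2.1, ?_⟩
      by_contra! hnx
      have heq : (⟨x, hxB⟩ : {x // x ∈ B}) = ⟨j, hjB⟩ :=
        hli.injective ((uipCol_of_lt hnx).trans (uipCol_of_lt hnj).symm)
      exact hxj (congrArg Subtype.val heq)
    have hsdiff : (Finset.Icc 1 n \ B.erase j).card = 1 := by
      rw [Finset.card_sdiff_of_subset herase, Finset.card_erase_of_mem hjB, hcard,
        Nat.card_Icc]
      omega
    obtain ⟨i, hi⟩ := Finset.card_eq_one.mp hsdiff
    have hi_mem : i ∈ Finset.Icc 1 n \ B.erase j := by simp [hi]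
    refine ⟨i, (Finset.mem_sdiff.mp hi_mem).1, j, Finset.mem_Icc.mpr ⟨hnj, hj2.2⟩, ?_⟩
    rw [← Finset.sdiff_singleton_eq_erase, ← hi, Finset.sdiff_sdiff_eq_self herase,
      Finset.insert_erase hjB]
  · rintro (rfl | ⟨i, hi, j, hj, rfl⟩)
    · exact ⟨⟨hB, linearIndepOn_uipCol subset_rfl⟩, hcard⟩
    · exact ⟨⟨hB, linearIndepOn_uipCol_insert_erase hi (Finset.mem_Icc.mp hj).1⟩, hcard⟩
end

section
/- Let n ≥ 1 and let B be a basis of the trivial unit interval positroid P_n with 1 ∈ B and B ≠ {1,…,n}. Let j = max B, so that n+1 ≤ j ≤ 2n. Then Ext(B) = {n+1, n+2, …, j−1} (the empty set when j = n+1). -/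
/-- The last `n` columns of `M(n)` coincide. -/
lemma uipCol_eq_of_lt {n a b : ℕ} (ha : n < a) (hb : n < b) : uipCol n a = uipCol n b := by
  funext i
  simp [uipCol, ha.not_ge, hb.not_ge]

/-- An independent set contains at most one of the last `n` elements. -/
lemma uipIndep.eq_of_lt {n : ℕ} {S : Finset ℕ} (hS : uipIndep n S) {a b : ℕ} (ha : a ∈ S)
    (hb : b ∈ S) (hna : n < a) (hnb : n < b) : a = b :=
  congrArg Subtype.val (hS.2.injective (a₁ := ⟨a, ha⟩) (a₂ := ⟨b, hb⟩) (uipCol_eq_of_lt hna hnb))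

/-- A set avoiding `1` with at most one of the last `n` elements is independent. -/
lemma uipIndep_of_one_notMem {n : ℕ} (hn : 1 ≤ n) {S : Finset ℕ}
    (hS : S ⊆ Finset.Icc 1 (2 * n)) (h1 : 1 ∉ S)
    (h : ∀ a ∈ S, ∀ b ∈ S, n < a → n < b → a = b) : uipIndep n S := by
  refine ⟨hS, Fintype.linearIndependent_iff.2 fun g hg => ?_⟩
  have hcoord (i : Fin n) : ∑ x : {x // x ∈ S}, g x * uipCol n x.1 i = 0 := by
    simpa using congrFun hg i
  have hlast (x : {x // x ∈ S}) (hx : n < x.1) : g x = 0 := by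
    have h0 := hcoord ⟨0, hn⟩
    rw [Finset.sum_eq_single x] at h0
    · simpa [uipCol, hx.not_ge] using h0
    · intro y _ hy
      have hyn : y.1 ≤ n := by
        by_contra! hlt
        exact hy (Subtype.ext (h _ y.2 _ x.2 hlt hx))
      have hy1 : 1 ≠ y.1 := fun he => h1 (he ▸ y.2)
      simp [uipCol, hyn, hy1]
    · simp
  intro x
  rcases lt_or_ge n x.1 with hx | hx
  · exact hlast x hx
  have hx1 : 1 ≤ x.1 := (Finset.mem_Icc.1 (hS x.2)).1
  have h0 := hcoord ⟨x.1 - 1, by omega⟩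
  rw [Finset.sum_eq_single x] at h0
  · simpa [uipCol, hx, Nat.sub_add_cancel hx1] using h0
  · intro y _ hy
    rcases lt_or_ge n y.1 with hyn | hyn
    · simp [hlast y hyn]
    have hxy : x.1 ≠ y.1 := fun he => hy (Subtype.ext he.symm)
    simp [uipCol, hyn, Nat.sub_add_cancel hx1, hxy]
  · simp

/-- Any two distinct elements among the last `n` form a circuit. -/
lemma uipCircuit_pair {n a b : ℕ} (hn : 1 ≤ n) (ha : n < a) (hab : a < b) (hb : b ≤ 2 * n) :
    uipCircuit n {a, b} := by
  have hsub : ({a, b} : Finset ℕ) ⊆ Finset.Icc 1 (2 * n) := by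
    intro x hx
    simp only [Finset.mem_insert, Finset.mem_singleton] at hx
    rw [Finset.mem_Icc]
    omega
  refine ⟨hsub, fun h => ?_, fun D hD => ?_⟩
  · exact hab.ne (h.eq_of_lt (by simp) (by simp) ha (ha.trans hab))
  · have hmem : ∀ x ∈ D, x = a ∨ x = b := fun x hx => by simpa using hD.1 hx
    refine uipIndep_of_one_notMem hn (hD.1.trans hsub) (fun h => ?_) fun x hx y hy _ _ => ?_
    · have := hmem 1 h
      omega
    · have hcard : D.card < 2 := by
        simpa [Finset.card_pair hab.ne] using Finset.card_lt_card hD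
      exact Finset.card_le_one.1 (by omega) x hx y hy

/-- For a basis B of P_n with 1 ∈ B and B ≠ {1,…,n}, setting j = max B we have
n+1 ≤ j ≤ 2n and Ext(B) = {n+1, …, j-1}. -/
theorem uip_ext_of_one_mem (n : ℕ) (hn : 1 ≤ n) (B : Finset ℕ) (hB : uipBasis n B)
    (h1 : 1 ∈ B) (hne : B ≠ Finset.Icc 1 n) (j : ℕ) (hj : j = B.max' ⟨1, h1⟩) :
    (n + 1 ≤ j ∧ j ≤ 2 * n) ∧ uipExt n B = Set.Icc (n + 1) (j - 1) := by
  have hjB : j ∈ B := hj ▸ B.max'_mem _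
  have hmax : ∀ x ∈ B, x ≤ j := fun x hx => hj ▸ B.le_max' x hx
  have hj2 : j ≤ 2 * n := (Finset.mem_Icc.1 (hB.1.1 hjB)).2
  have hnj : n < j := by
    by_contra! hle
    refine hne (Finset.eq_of_subset_of_card_le (fun x hx => ?_) (by simp [hB.2]))
    exact Finset.mem_Icc.2 ⟨(Finset.mem_Icc.1 (hB.1.1 hx)).1, (hmax x hx).trans hle⟩
  refine ⟨⟨hnj, hj2⟩, Set.ext fun e => ⟨?_, fun he => ?_⟩⟩
  · rintro ⟨⟨C, ⟨hCsub, hCdep, -⟩, heC, hCB, hmin⟩, heB⟩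
    have hCmem : ∀ x ∈ C, x = e ∨ x ∈ B := fun x hx => by simpa using hCB hx
    have he1 : 1 ≠ e := fun h => heB (h ▸ h1)
    have he0 : 1 ≤ e := (Finset.mem_Icc.1 (hCsub heC)).1
    have hC1 : 1 ∉ C := fun h => by
      have := hmin 1 h
      omega
    by_contra hcon
    simp only [Set.mem_Icc] at hcon
    refine hCdep (uipIndep_of_one_notMem hn hCsub hC1 fun a ha b hb hna hnb => ?_)
    rcases le_or_gt e n with hen | hen
    · exact hB.1.eq_of_lt ((hCmem a ha).resolve_left (by omega))
        ((hCmem b hb).resolve_left (by omega)) hna hnb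
    · have hCe : ∀ x ∈ C, x = e := fun x hx => by
        refine (hCmem x hx).resolve_right fun hxB => ?_
        have hxe : x ≠ e := fun h => heB (h ▸ hxB)
        have := hmin x hx
        have := hmax x hxB
        omega
      rw [hCe a ha, hCe b hb]
  · rw [Set.mem_Icc] at he
    have hej : e < j := by omega
    refine ⟨⟨{e, j}, uipCircuit_pair hn (by omega) hej hj2, by simp, ?_, ?_⟩, fun h => ?_⟩
    · exact Finset.insert_subset_insert e (by simpa using hjB)
    · simp [hej.le]
    · exact hej.ne (hB.1.eq_of_lt h hjB (by omega) hnj)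
end

section
/- Let n ≥ 1 and let B be a basis of the trivial unit interval positroid P_n that is minimal with respect to the external order (i.e., the only basis A of P_n with A ≤_Ext B is A = B). Then 1 ∈ B. -/
theorem uipIndep_iff_linearIndepOn {n : ℕ} {S : Finset ℕ} :
    uipIndep n S ↔ S ⊆ Finset.Icc 1 (2 * n) ∧ LinearIndepOn ℚ (uipCol n) (S : Set ℕ) :=
  Iff.rfl

theorem uipIndep.subset {n : ℕ} {S T : Finset ℕ} (hT : uipIndep n T) (hST : S ⊆ T) :
    uipIndep n S := by
  rw [uipIndep_iff_linearIndepOn] at hT ⊢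
  exact ⟨hST.trans hT.1, hT.2.mono (Finset.coe_subset.2 hST)⟩

theorem uipIndep.card_le {n : ℕ} {S : Finset ℕ} (hS : uipIndep n S) : S.card ≤ n := by
  simpa using hS.2.fintype_card_le_finrank

theorem uipIndep_singleton_one {n : ℕ} (hn : 1 ≤ n) : uipIndep n {1} := by
  rw [uipIndep_iff_linearIndepOn, Finset.coe_singleton, linearIndepOn_singleton_iff]
  refine ⟨by simp; omega, fun h => ?_⟩
  simpa [uipCol, hn] using congrFun h ⟨0, hn⟩

/-- Every dependent subset of the ground set contains a circuit. -/
theorem exists_uipCircuit_subset {n : ℕ} {S : Finset ℕ} (hS : S ⊆ Finset.Icc 1 (2 * n))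
    (hdep : ¬ uipIndep n S) : ∃ C ⊆ S, uipCircuit n C := by
  obtain ⟨C, hCS, hC⟩ := exists_minimal_le_of_wellFoundedLT (fun T => ¬ uipIndep n T) S hdep
  exact ⟨C, hCS, hCS.trans hS, hC.prop, fun D hD => not_not.1 (hC.not_prop_of_lt hD)⟩

/-- Exchanging an element of the fundamental circuit of `e` with `e` preserves independence. -/
theorem uipIndep.insert_erase {n : ℕ} {B C : Finset ℕ} {e x : ℕ} (hB : uipIndep n B)
    (hC : uipCircuit n C) (heC : e ∈ C) (hCB : C ⊆ insert e B) (heB : e ∉ B) (hxC : x ∈ C)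
    (hxe : x ≠ e) : uipIndep n (insert e (B.erase x)) := by
  obtain ⟨hCground, hCdep, hCmin⟩ := hC
  have hxB : x ∈ B := Finset.mem_of_mem_insert_of_ne (hCB hxC) hxe
  have hsub : (C.erase e).erase x ⊆ B.erase x :=
    Finset.erase_subset_erase x (Finset.subset_insert_iff.1 hCB)
  have hCe := uipIndep_iff_linearIndepOn.1 (hCmin _ (Finset.erase_ssubset heC))
  have hCx := uipIndep_iff_linearIndepOn.1 (hCmin _ (Finset.erase_ssubset hxC))
  have hCe_eq : C.erase e = insert x ((C.erase e).erase x) := by grind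
  have hCx_eq : C.erase x = insert e ((C.erase e).erase x) := by grind
  have hspan : uipCol n e ∈ Submodule.span ℚ (uipCol n '' (C.erase e : Finset ℕ)) := by
    by_contra h
    refine hCdep (uipIndep_iff_linearIndepOn.2 ⟨hCground, ?_⟩)
    rw [← Finset.insert_erase heC, Finset.coe_insert]
    exact hCe.2.insert h
  have hnspan : uipCol n e ∉ Submodule.span ℚ (uipCol n '' ((C.erase e).erase x : Finset ℕ)) := by
    have h := hCx.2
    rw [hCx_eq, Finset.coe_insert, linearIndepOn_insert (by simp)] at h
    exact h.2
  rw [hCe_eq, Finset.coe_insert, Set.image_insert_eq] at hspan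
  have hx := mem_span_insert_exchange hspan hnspan
  have hBx := uipIndep_iff_linearIndepOn.1 (hB.subset (Finset.erase_subset x B))
  have hxn : uipCol n x ∉ Submodule.span ℚ (uipCol n '' (B.erase x : Finset ℕ)) := by
    have h := (uipIndep_iff_linearIndepOn.1 hB).2
    rw [← Finset.insert_erase hxB, Finset.coe_insert, linearIndepOn_insert (by simp)] at h
    exact h.2
  refine uipIndep_iff_linearIndepOn.2
    ⟨Finset.insert_subset (hCground heC) hBx.1, ?_⟩
  rw [Finset.coe_insert]
  refine hBx.2.insert fun h => hxn ?_
  refine Submodule.span_le.2 (Set.insert_subset h ?_) hx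
  exact (Set.image_mono (Finset.coe_subset.2 hsub)).trans Submodule.subset_span

/-- A basis of P_n that is minimal in the external order contains 1. -/
theorem uip_minimal_mem_one (n : ℕ) (hn : 1 ≤ n) (B : Finset ℕ) (hB : uipBasis n B)
    (hmin : ∀ A : Finset ℕ, uipBasis n A → uipExtLe n A B → A = B) :
    1 ∈ B := by
  by_contra h1
  obtain ⟨hBi, hcard⟩ := hB
  have hground : insert 1 B ⊆ Finset.Icc 1 (2 * n) :=
    Finset.insert_subset (by simp; omega) hBi.1
  have hdep : ¬ uipIndep n (insert 1 B) := fun h => by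
    have := h.card_le
    rw [Finset.card_insert_of_notMem h1] at this
    omega
  obtain ⟨C, hCB, hC⟩ := exists_uipCircuit_subset hground hdep
  have h1C : 1 ∈ C := by
    by_contra h
    exact hC.2.1 (hBi.subset ((Finset.subset_insert_iff_of_notMem h).1 hCB))
  obtain ⟨x, hxC, hx1⟩ : ∃ x ∈ C, x ≠ 1 := by
    by_contra! h
    exact hC.2.1 ((uipIndep_singleton_one hn).subset fun x hx => by simp [h x hx])
  have hxB : x ∈ B := Finset.mem_of_mem_insert_of_ne (hCB hxC) hx1
  have hA : insert 1 (B.erase x) = B := by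
    refine hmin _ ⟨hBi.insert_erase hC h1C hCB h1 hxC hx1, ?_⟩ fun y hy => ?_
    · rw [Finset.card_insert_of_notMem (by simp [h1]), Finset.card_erase_add_one hxB, hcard]
    · rcases Finset.mem_insert.1 (Finset.mem_coe.1 hy) with rfl | hy
      · exact Or.inr ⟨⟨C, hC, h1C, hCB, fun z hz => (Finset.mem_Icc.1 (hC.1 hz)).1⟩, h1⟩
      · exact Or.inl (Finset.mem_of_mem_erase hy)
  exact h1 (hA ▸ Finset.mem_insert_self 1 _)
end

section
/- Let n ≥ 1 and let A be an n × n real matrix. Define the n × 2n matrix B = ψ(A) by B_{i,j} = 1 if j ≤ n and i = j, B_{i,j} = 0 if j ≤ n and i ≠ j, and B_{i, n+j} = (−1)^{n−i} · A_{n+1−i, j} for 1 ≤ i ≤ n and 1 ≤ j ≤ n. Let I, J ⊆ {1,…,n} with |I| = |J|, and set K = {n+1−k : k ∈ {1,…,n} \ I} ∪ {n+j : j ∈ J}, a subset of {1,…,2n} of size n. Then the minor Δ_{I,J}(A) (the determinant of the square submatrix of A with rows indexed by I and columns by J, each listed in increasing order) equals the maximal minor Δ_{{1,…,n},K}(B)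 (the determinant of the square submatrix of B with all n rows and columns indexed by K, listed in increasing order). -/
/-- If `c` lists `k` numbers below `n` increasingly and `g` lists the other `m` ones, then the minor
of `A` with rows `g` equals the determinant of the `n × n` matrix made of the unit
columns selected by `c` and of the rows of `A` taken in reverse order with alternating signs. -/
theorem det_unitColumns_append_eq_minor (n : ℕ) :
    ∀ (k m : ℕ) (_ : k + m = n) (c g : ℕ → ℕ) (A : ℕ → ℕ → ℝ)
      (_ : ∀ a < k, c a < n) (_ : ∀ a < m, g a < n)
      (_ : ∀ b < k, ∀ a < b, c a < c b) (_ : ∀ b < m, ∀ a < b, g a < g b)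
      (_ : ∀ a < k, ∀ b < m, c a ≠ g b)
      (_ : ∀ x < n, (∃ a < k, c a = x) ∨ (∃ a < m, g a = x)),
      (Matrix.of fun i j : Fin n =>
        if (j : ℕ) < k then (if n - 1 - (i : ℕ) = c (k - 1 - j) then (1 : ℝ) else 0)
        else (-1 : ℝ) ^ (n - 1 - (i : ℕ)) * A (n - 1 - i) (j - k)).det =
      (Matrix.of fun a b : Fin m => A (g a) b).det := by
  induction n with
  | zero =>
    intro k m h
    obtain rfl : m = 0 := by omega
    intros
    simp
  | succ N ih =>
    intro k m hkm c g A hc hg hcm hgm hd hs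
    rcases hs N (by omega) with ⟨a, hak, ha⟩ | ⟨a, ham, ha⟩
    · obtain ⟨k, rfl⟩ : ∃ k', k = k' + 1 := ⟨k - 1, by omega⟩
      obtain rfl : a = k := by
        by_contra hne
        have := hcm k (by omega) a (by omega)
        have := hc k (by omega)
        omega
      have hc' : ∀ b < a, c b < N := fun b hb => ha ▸ hcm a (by omega) b hb
      have hg' : ∀ b < m, g b < N := fun b hb => by
        have := hg b hb
        have := hd a (by omega) b hb
        omega
      rw [← ih a m (by omega) c g A hc' hg' (fun b hb => hcm b (by omega)) hgm
        (fun x hx => hd x (by omega)) (fun x hx => by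
          rcases hs x (by omega) with ⟨y, hy, rfl⟩ | h
          · refine Or.inl ⟨y, ?_, rfl⟩
            rcases Nat.lt_succ_iff_lt_or_eq.1 hy with h | rfl <;> omega
          · exact Or.inr h)]
      rw [Matrix.det_succ_column_zero, Finset.sum_eq_single 0]
      · rw [Matrix.of_apply, if_pos (by simp), if_pos (by simp [ha])]
        simp only [Fin.val_zero, pow_zero, one_mul]
        congr 1
        ext i j
        have hi : N + 1 - 1 - (i.succ : ℕ) = N - 1 - i := by
          rw [Fin.val_succ]
          omega
        have hj : a + 1 - 1 - (j.succ : ℕ) = a - 1 - j := by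
          rw [Fin.val_succ]
          omega
        simp only [Matrix.submatrix_apply, Matrix.of_apply, Fin.zero_succAbove, hi, hj]
        simp only [Fin.val_succ, Nat.add_lt_add_iff_right, Nat.add_sub_add_right]
      · intro i _ hi
        have hi' : (i : ℕ) ≠ 0 := fun h => hi (Fin.ext h)
        rw [Matrix.of_apply, if_pos (by simp), if_neg (by simp [ha]; omega)]
        simp
      · simp
    · obtain ⟨m, rfl⟩ : ∃ m', m = m' + 1 := ⟨m - 1, by omega⟩
      obtain rfl : a = m := by
        by_contra hne
        have := hgm m (by omega) a (by omega)
        have := hg m (by omega)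
        omega
      obtain rfl : N = k + a := by omega
      have hg' : ∀ b < a, g b < k + a := fun b hb => ha ▸ hgm a (by omega) b hb
      have hc' : ∀ b < k, c b < k + a := fun b hb => by
        have := hc b hb
        have := hd b hb a (by omega)
        omega
      have ih' := fun A' => ih k a rfl c g A' hc' hg' hcm (fun b hb => hgm b (by omega))
        (fun x hx y hy => hd x hx y (by omega)) (fun x hx => by
          rcases hs x (by omega) with h | ⟨y, hy, rfl⟩
          · exact Or.inl h
          · refine Or.inr ⟨y, ?_, rfl⟩
            rcases Nat.lt_succ_iff_lt_or_eq.1 hy with h | rfl <;> omega)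
      rw [Matrix.det_succ_row_zero, Matrix.det_succ_row _ (Fin.last a)]
      refine (Fin.sum_univ_add (a := k) (b := a + 1) _).trans ?_
      rw [Finset.sum_eq_zero, zero_add]
      · refine Finset.sum_congr rfl fun b _ => ?_
        have h := ih' fun i j => A i (if j < (b : ℕ) then j else j + 1)
        have hR : (Matrix.of fun x y : Fin a => A (g x) (if (y : ℕ) < b then y else y + 1)) =
            (Matrix.of fun x y : Fin (a + 1) => A (g x) y).submatrix
              (Fin.last a).succAbove b.succAbove := by
          ext x y
          simp only [Matrix.submatrix_apply, Matrix.of_apply, Fin.succAbove_last,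
            Fin.val_castSucc]
          congr 1
          simp only [Fin.succAbove, Fin.lt_def, Fin.val_castSucc]
          split_ifs <;> simp
        rw [← hR, ← h]
        simp only [Matrix.of_apply, Fin.val_natAdd, Fin.val_zero, Fin.val_last]
        rw [if_neg (by omega), show k + a + 1 - 1 - 0 = k + a by omega, ha,
          show k + (b : ℕ) - k = b by omega]
        have hs : (-1 : ℝ) ^ (k + (b : ℕ)) * ((-1) ^ (k + a) * A (k + a) b) =
            (-1) ^ (a + (b : ℕ)) * A (k + a) b := by
          have : (-1 : ℝ) ^ k * (-1) ^ k = 1 := by rw [← mul_pow]; simp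
          rw [pow_add, pow_add, pow_add]
          linear_combination ((-1 : ℝ) ^ a * (-1) ^ (b : ℕ) * A (k + a) b) * this
        rw [hs]
        congr 2
        ext i j
        have hj : (((Fin.natAdd k b : Fin (k + (a + 1))).succAbove j : Fin (k + (a + 1))) : ℕ) =
            if (j : ℕ) < k + b then (j : ℕ) else j + 1 := by
          simp only [Fin.succAbove, Fin.lt_def, Fin.val_castSucc, Fin.val_natAdd]
          split_ifs <;> simp
        have hi : k + a + 1 - 1 - (i.succ : ℕ) = k + a - 1 - i := by
          rw [Fin.val_succ]
          omega
        simp only [Matrix.submatrix_apply, Matrix.of_apply, hi]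
        rw [hj]
        by_cases h1 : (j : ℕ) < k
        · rw [if_pos (show (j : ℕ) < k + b by omega), if_pos h1, if_pos h1]
        · rw [if_neg h1, if_neg (by split_ifs <;> omega)]
          congr 2
          split_ifs <;> omega
      · intro j _
        have hne : k + a + 1 - 1 - ((0 : Fin (k + a + 1)) : ℕ) ≠
            c (k - 1 - (Fin.castAdd (a + 1) j : ℕ)) := by
          have := hc' (k - 1 - j) (by omega)
          simp only [Fin.val_castAdd, Fin.val_zero]
          omega
        rw [Matrix.of_apply, if_pos (by simp), if_neg hne]
        simp


/-- **Postnikov's Lemma 3.9.** Let A be an n × n real matrix and B = ψ(A) the n × 2n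
matrix whose first n columns form the identity and whose (n+j)-th column has i-th entry
(-1)^(n-i) · A_{n+1-i, j} (1-indexed; realized here with 0-indexed `Fin`). For
I, J ⊆ {1,…,n} with |I| = |J| and K = {n+1-k : k ∈ {1,…,n} \ I} ∪ {n+j : j ∈ J}
(a subset of {1,…,2n} of size n), the minor Δ_{I,J}(A) equals the maximal minor
Δ_{{1,…,n},K}(B). -/
theorem postnikov_minor_identity (n : ℕ) (hn : 1 ≤ n)
    (A : Matrix (Fin n) (Fin n) ℝ) (B : Matrix (Fin n) (Fin (2 * n)) ℝ)
    (hB : ∀ (i : Fin n) (j : Fin (2 * n)),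
      B i j = if h : (j : ℕ) < n then (if (i : ℕ) = (j : ℕ) then 1 else 0)
        else (-1 : ℝ) ^ (n - 1 - (i : ℕ)) *
          A ⟨n - 1 - (i : ℕ), by omega⟩ ⟨(j : ℕ) - n, by omega⟩)
    (I J : Finset (Fin n)) (m : ℕ) (hI : I.card = m) (hJ : J.card = m)
    (K : Finset (Fin (2 * n)))
    (hK : K = Iᶜ.image (fun k : Fin n => (⟨n - 1 - (k : ℕ), by omega⟩ : Fin (2 * n)))
      ∪ J.image (fun j : Fin n => (⟨n + (j : ℕ), by omega⟩ : Fin (2 * n))))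
    (hKcard : K.card = n) :
    (A.submatrix (fun t : Fin m => ((I.orderIsoOfFin hI t : Fin n)))
      (fun t : Fin m => ((J.orderIsoOfFin hJ t : Fin n)))).det =
    (B.submatrix id
      (fun t : Fin n => ((K.orderIsoOfFin hKcard t : Fin (2 * n))))).det := by
  have hmn : m ≤ n := by simpa [hI] using Finset.card_le_univ I
  have hIc : Iᶜ.card = n - m := by simp [Finset.card_compl, hI]
  let e := Iᶜ.orderEmbOfFin hIc
  let p := I.orderEmbOfFin hI
  let q := J.orderEmbOfFin hJ
  let c : ℕ → ℕ := fun a => if h : a < n - m then e ⟨a, h⟩ else 0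
  let g : ℕ → ℕ := fun a => if h : a < m then p ⟨a, h⟩ else 0
  let C : ℕ → ℕ → ℝ := fun i b => if h : i < n ∧ b < m then A ⟨i, h.1⟩ (q ⟨b, h.2⟩) else 0
  have hc : ∀ a (h : a < n - m), c a = e ⟨a, h⟩ := fun a h => dif_pos h
  have hg : ∀ a (h : a < m), g a = p ⟨a, h⟩ := fun a h => dif_pos h
  have key := det_unitColumns_append_eq_minor n (n - m) m (by omega) c g C
    (fun a h => by rw [hc a h]; exact Fin.is_lt _)
    (fun a h => by rw [hg a h]; exact Fin.is_lt _)
    (fun b hb a hab => by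
      rw [hc b hb, hc a (by omega)]
      exact e.strictMono (Fin.mk_lt_mk.2 hab))
    (fun b hb a hab => by
      rw [hg b hb, hg a (by omega)]
      exact p.strictMono (Fin.mk_lt_mk.2 hab))
    (fun a ha b hb hab => by
      rw [hc a ha, hg b hb] at hab
      have h1 := Finset.orderEmbOfFin_mem Iᶜ hIc ⟨a, ha⟩
      have h2 := Finset.orderEmbOfFin_mem I hI ⟨b, hb⟩
      rw [Finset.mem_compl] at h1
      exact h1 ((Fin.ext hab : e ⟨a, ha⟩ = p ⟨b, hb⟩) ▸ h2))
    (fun x hx => by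
      by_cases hxI : (⟨x, hx⟩ : Fin n) ∈ I
      · rw [← Finset.mem_coe, ← Finset.range_orderEmbOfFin I hI] at hxI
        obtain ⟨a, ha⟩ := hxI
        exact Or.inr ⟨a, a.2, by rw [hg a a.2]; exact congrArg Fin.val ha⟩
      · rw [← Finset.mem_compl, ← Finset.mem_coe, ← Finset.range_orderEmbOfFin Iᶜ hIc] at hxI
        obtain ⟨a, ha⟩ := hxI
        exact Or.inl ⟨a, a.2, by rw [hc a a.2]; exact congrArg Fin.val ha⟩)
  let f : Fin n → Fin (2 * n) := fun t =>
    if h : (t : ℕ) < n - m then ⟨n - 1 - e ⟨n - m - 1 - t, by omega⟩, by omega⟩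
    else ⟨n + q ⟨t - (n - m), by omega⟩, by omega⟩
  have hfK : ∀ t, f t ∈ K := fun t => by
    rw [hK, Finset.mem_union, Finset.mem_image, Finset.mem_image]
    by_cases h : (t : ℕ) < n - m
    · exact Or.inl ⟨_, Finset.orderEmbOfFin_mem Iᶜ hIc ⟨n - m - 1 - t, by omega⟩,
        by simp only [f, dif_pos h]; rfl⟩
    · exact Or.inr ⟨_, Finset.orderEmbOfFin_mem J hJ ⟨t - (n - m), by omega⟩,
        by simp only [f, dif_neg h]; rfl⟩
  have hfm : StrictMono f := fun s t hst => by
    rw [Fin.lt_def] at hst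
    by_cases ht : (t : ℕ) < n - m
    · have hs : (s : ℕ) < n - m := by omega
      have h : e ⟨n - m - 1 - t, by omega⟩ < e ⟨n - m - 1 - s, by omega⟩ :=
        e.strictMono (Fin.mk_lt_mk.2 (by omega))
      simp only [f, dif_pos hs, dif_pos ht, Fin.lt_def] at h ⊢
      omega
    · by_cases hs : (s : ℕ) < n - m
      · simp only [f, dif_pos hs, dif_neg ht, Fin.lt_def]
        omega
      · have h : q ⟨s - (n - m), by omega⟩ < q ⟨t - (n - m), by omega⟩ :=
          q.strictMono (Fin.mk_lt_mk.2 (by omega))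
        simp only [f, dif_neg hs, dif_neg ht, Fin.lt_def] at h ⊢
        omega
  have hf : ∀ t, (K.orderIsoOfFin hKcard t : Fin (2 * n)) = f t := fun t =>
    (congrFun (Finset.orderEmbOfFin_unique hKcard hfK hfm) t).symm
  convert key.symm using 2
  · ext a b
    simp only [Matrix.submatrix_apply, Matrix.of_apply, C]
    rw [hg a a.2, dif_pos ⟨Fin.is_lt _, b.2⟩]
    rfl
  · ext i t
    simp only [Matrix.submatrix_apply, Matrix.of_apply, hf, hB, id]
    by_cases h : (t : ℕ) < n - m
    · rw [if_pos h, hc _ (by omega), dif_pos (by simp only [f, dif_pos h]; omega)]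
      simp only [f, dif_pos h]
      congr 1
      exact propext (by omega)
    · rw [if_neg h, dif_neg (by simp only [f, dif_neg h]; omega)]
      simp only [f, dif_neg h, C]
      rw [dif_pos ⟨by omega, by omega⟩]
      congr 3
      exact Nat.add_sub_cancel_left ..
end
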